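/- Let (μ, ν) be a regular pair of standard Weyl pairs, and set P = X_μ^{-1}⊗Id + Y_μ⊗Y_ν^{-1} and Q = q^{-1}·Y_μ⊗X_ν^{-1}Y_ν^{-1} in End(ℂ^N ⊗ ℂ^N) (P is invertible by regularity). Then there is a unique pair (X̂, Ŷ) of linear endomorphisms of the Clebsch–Gordan space V_{(μ,ν)} such that for all f ∈ V_{(μ,ν)} and w ∈ ℂ^N one has (X̂f)(w) = P^{-1}(f(w)) and (Ŷf)(X_{μν}(w)) = (q^{-1}·X_μY_μ ⊗ Y_ν^{-1})(f(w)); explicitly Ŷf = Q∘f; these operators are well defined in the sense that P^{-1}∘f and Q∘f again lie in V_{(μ,ν)} for every f ∈ V_{(μ,ν)}; and (X̂, Ŷ) is a Weyl pair on V_{(μ,ν)}, i.e. both operators are invertible and X̂Ŷ = q^2·ŶX̂. -/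

import Mathlib

open TensorProduct

noncomputable section

/-- ℂ^N: functions from ℤ/Nℤ to ℂ. -/
abbrev CN (N : ℕ) := ZMod N → ℂ

/-- The operator A with A e_k = q^{2k} e_k. -/
def opA (q : ℂ) (N : ℕ) : Module.End ℂ (CN N) where
  toFun f := fun k => q ^ (2 * k.val) * f k
  map_add' f g := by funext k; simp [mul_add]
  map_smul' c f := by funext k; simp [smul_eq_mul]; ring

/-- The operator B with B e_k = e_{k+1}. -/
def opB (N : ℕ) : Module.End ℂ (CN N) where
  toFun f := fun k => f (k - 1)
  map_add' f g := by funext k; simp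
  map_smul' c f := by funext k; simp

/-- The operator C with C e_k = q^{1-2k} e_{k-1}, i.e. (C f)(k) = q^{-1-2k} f(k+1). -/
def opC (q : ℂ) (N : ℕ) : Module.End ℂ (CN N) where
  toFun f := fun k => q ^ (-1 - 2 * (k.val : ℤ)) * f (k + 1)
  map_add' f g := by funext k; simp [mul_add]
  map_smul' c f := by funext k; simp [smul_eq_mul]; ring

/-- A Weyl pair: invertible endomorphisms with X Y = q² Y X. -/
def IsWeylPair (q : ℂ) {V : Type*} [AddCommMonoid V] [Module ℂ V]
    (X Y : Module.End ℂ V) : Prop :=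
  IsUnit X ∧ IsUnit Y ∧ X * Y = q ^ 2 • (Y * X)

/-- A subspace invariant under both X and Y. -/
def WeylInvariant {V : Type*} [AddCommMonoid V] [Module ℂ V]
    (X Y : Module.End ℂ V) (W : Submodule ℂ V) : Prop :=
  (∀ v ∈ W, X v ∈ W) ∧ (∀ v ∈ W, Y v ∈ W)

/-- An irreducible Weyl pair. -/
def IsIrreducibleWeylPair (q : ℂ) {V : Type*} [AddCommMonoid V] [Module ℂ V]
    (X Y : Module.End ℂ V) : Prop :=
  IsWeylPair q X Y ∧ Nontrivial V ∧
    ∀ W : Submodule ℂ V, WeylInvariant X Y W → W = ⊥ ∨ W = ⊤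
/-- The Clebsch–Gordan space of a pair of Weyl pairs: all linear maps
f : ℂ^N → ℂ^N ⊗ ℂ^N with f∘X_{αβ} = (X_α⊗X_β)∘f and
f∘Y_{αβ} = (X_α⁻¹⊗Y_β + Y_α⊗Id)∘f. -/
def CGsub (N : ℕ) (Xa Ya Xb Yb Xab Yab : Module.End ℂ (CN N)) :
    Submodule ℂ (CN N →ₗ[ℂ] (CN N ⊗[ℂ] CN N)) where
  carrier := {f | f ∘ₗ Xab = (TensorProduct.map Xa Xb) ∘ₗ f ∧
    f ∘ₗ Yab = (TensorProduct.map (Ring.inverse Xa) Yb + TensorProduct.map Ya 1) ∘ₗ f}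
  add_mem' := by
    rintro f g ⟨hf1, hf2⟩ ⟨hg1, hg2⟩
    constructor <;> simp only [LinearMap.add_comp, LinearMap.comp_add, hf1, hf2, hg1, hg2]
  zero_mem' := by constructor <;> simp
  smul_mem' := by
    rintro c f ⟨hf1, hf2⟩
    constructor <;> simp only [LinearMap.smul_comp, LinearMap.comp_smul, hf1, hf2]


lemma opA_pow (q : ℂ) (N n : ℕ) (f : CN N) (k : ZMod N) :
    ((opA q N) ^ n) f k = (q ^ (2 * k.val)) ^ n * f k := by
  induction n generalizing f with
  | zero => simp
  | succ n ih =>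
    rw [pow_succ, Module.End.mul_apply, ih]
    simp only [opA, LinearMap.coe_mk, AddHom.coe_mk]
    ring

lemma opA_pow_N (q : ℂ) (N : ℕ) (hq : (q ^ 2) ^ N = 1) : (opA q N) ^ N = 1 := by
  refine LinearMap.ext fun x => funext fun k => ?_
  rw [opA_pow, pow_mul, ← pow_mul, mul_comm k.val, pow_mul, hq]
  simp

lemma opB_pow (N n : ℕ) (f : CN N) (k : ZMod N) :
    ((opB N) ^ n) f k = f (k - n) := by
  induction n generalizing f with
  | zero => simp
  | succ n ih =>
    rw [pow_succ, Module.End.mul_apply, ih]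
    simp only [opB, LinearMap.coe_mk, AddHom.coe_mk]
    congr 1
    push_cast
    ring

lemma opB_pow_N (N : ℕ) : (opB N) ^ N = 1 := by
  refine LinearMap.ext fun x => funext fun k => ?_
  rw [opB_pow]
  simp

lemma opAB (q : ℂ) (N : ℕ) [NeZero N] (hq : (q ^ 2) ^ N = 1) :
    opA q N * opB N = q ^ 2 • (opB N * opA q N) := by
  refine LinearMap.ext fun x => funext fun k => ?_
  have key : ∀ j : ZMod N, (q ^ 2) ^ (j + 1).val = q ^ 2 * (q ^ 2) ^ j.val := by
    intro j
    rw [ZMod.val_add, ← pow_eq_pow_mod _ hq, pow_add, ZMod.val_one_eq_one_mod,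
      ← pow_eq_pow_mod _ hq, pow_one, mul_comm]
  have := key (k - 1)
  simp only [sub_add_cancel] at this
  simp only [Module.End.mul_apply, LinearMap.smul_apply, Pi.smul_apply, opA, opB,
    LinearMap.coe_mk, AddHom.coe_mk, pow_mul, this, smul_eq_mul]
  ring

lemma root_sign (w : ℂ) (N : ℕ) (hN : 1 ≤ N) (h : IsPrimitiveRoot w N) :
    w ^ (N * (N - 1) / 2) = (-1) ^ (N - 1) := by
  rcases Nat.even_or_odd' N with ⟨m, rfl | rfl⟩
  · have hm : w ^ m = -1 := by
      have h1 : (w ^ m) ^ 2 = 1 := by rw [← pow_mul, mul_comm, h.pow_eq_one]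
      have h2 : w ^ m ≠ 1 := h.pow_ne_one_of_pos_of_lt (by omega) (by omega)
      rcases (by simpa using h1 : w ^ m = 1 ∨ w ^ m = -1) with h | h
      · exact absurd h h2
      · exact h
    rw [mul_assoc, Nat.mul_div_cancel_left _ (by norm_num), pow_mul, hm]
  · have : (2 * m + 1) * (2 * m + 1 - 1) / 2 = (2 * m + 1) * m := by
      rw [Nat.add_sub_cancel, show (2 * m + 1) * (2 * m) = 2 * ((2 * m + 1) * m) by ring,
        Nat.mul_div_cancel_left _ (by norm_num)]
    rw [this, pow_mul, h.pow_eq_one]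
    simp [pow_mul]

section alg
variable {R : Type*} [Ring R] [Algebra ℂ R]

lemma weyl_pow_comm (w : ℂ) (a b : R) (h : a * b = w • (b * a)) (n : ℕ) :
    a ^ n * b = w ^ n • (b * a ^ n) := by
  induction n with
  | zero => simp
  | succ n ih =>
    rw [pow_succ', mul_assoc, ih, mul_smul_comm, ← mul_assoc, h, smul_mul_assoc, smul_smul,
      mul_assoc, pow_succ]

lemma weyl_pow (w : ℂ) (a b : R) (h : a * b = w • (b * a)) (n : ℕ) :
    (b * a) ^ n = w ^ (n * (n - 1) / 2) • (b ^ n * a ^ n) := by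
  induction n with
  | zero => simp
  | succ n ih =>
    have e : (n + 1) * (n + 1 - 1) / 2 = n * (n - 1) / 2 + n := by
      have := Finset.sum_range_id n
      have h2 := Finset.sum_range_id (n + 1)
      rw [Finset.sum_range_succ] at h2
      omega
    rw [pow_succ, ih, e, smul_mul_assoc, mul_assoc, ← mul_assoc (a ^ n), weyl_pow_comm w a b h,
      smul_mul_assoc, mul_smul_comm, smul_smul, pow_add, pow_succ, pow_succ]
    simp only [mul_assoc]

lemma unit_one_add (z : R) (N : ℕ) (c : ℂ) (hz : z ^ N = c • 1)
    (hc : (-1) ^ N * c ≠ 1) : IsUnit (1 + z) := by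
  replace hz : (-z) ^ N = ((-1) ^ N * c) • 1 := by
    rw [← neg_one_smul ℂ z, smul_pow, hz, smul_smul]
  generalize (-1) ^ N * c = c at hz hc
  have h1 := mul_neg_geom_sum (-z) N
  have h2 := geom_sum_mul_neg (-z) N
  rw [hz, sub_neg_eq_add] at h1 h2
  have hs : (1 : R) - c • 1 = (1 - c) • 1 := by rw [sub_smul, one_smul]
  rw [hs] at h1 h2
  have hc' : 1 - c ≠ 0 := sub_ne_zero.mpr (Ne.symm hc)
  refine ⟨⟨1 + z, (1 - c)⁻¹ • ∑ i ∈ Finset.range N, (-z) ^ i, ?_, ?_⟩, rfl⟩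
  · rw [mul_smul_comm, h1, smul_smul, inv_mul_cancel₀ hc', one_smul]
  · rw [smul_mul_assoc, h2, smul_smul, inv_mul_cancel₀ hc', one_smul]

lemma inverse_smul' (c : ℂ) (hc : c ≠ 0) (a b : R) (h1 : a * b = 1) (h2 : b * a = 1) :
    Ring.inverse (c • a) = c⁻¹ • b := by
  have : c • a = ((⟨c • a, c⁻¹ • b, by simp [smul_smul, h1, hc], by simp [smul_smul, h2, hc]⟩ : Rˣ) : R) := rfl
  rw [this, Ring.inverse_unit]
  rfl

lemma weyl_inv_left (w : ℂ) (hw : w ≠ 0) (a b ai : R) (h : a * b = w • (b * a))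
    (h1 : a * ai = 1) (h2 : ai * a = 1) : ai * b = w⁻¹ • (b * ai) := by
  have : ai * (a * b) * ai = ai * (w • (b * a)) * ai := by rw [h]
  rw [← mul_assoc, h2, one_mul, mul_smul_comm, smul_mul_assoc, mul_assoc, mul_assoc, h1,
    mul_one] at this
  rw [this, smul_smul, inv_mul_cancel₀ hw, one_smul]

lemma weyl_inv_right (w : ℂ) (hw : w ≠ 0) (a b bi : R) (h : a * b = w • (b * a))
    (h1 : b * bi = 1) (h2 : bi * b = 1) : a * bi = w⁻¹ • (bi * a) := by
  have : bi * (a * b) * bi = bi * (w • (b * a)) * bi := by rw [h]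
  rw [mul_assoc, mul_assoc, h1, mul_one, mul_smul_comm, smul_mul_assoc, ← mul_assoc, h2,
    one_mul] at this
  rw [this, smul_smul, inv_mul_cancel₀ hw, one_smul]

end alg


section tens
variable {V : Type*} [AddCommGroup V] [Module ℂ V]

lemma tens_facts (q : ℂ) (hq : q ≠ 0) (A B Ai Bi : Module.End ℂ V)
    (a1 : A * Ai = 1) (a2 : Ai * A = 1) (b1 : B * Bi = 1) (b2 : Bi * B = 1)
    (h : A * B = q ^ 2 • (B * A)) (c1 c2 c3 c4 d : ℂ)
    (hc : c1 * c4 = c2 * c3) :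
    (TensorProduct.map A A * (c1 • TensorProduct.map Ai 1 + c2 • TensorProduct.map B Bi) = (c1 • TensorProduct.map Ai 1 + c2 • TensorProduct.map B Bi) * TensorProduct.map A A) ∧
    ((c3 • TensorProduct.map Ai B + c4 • TensorProduct.map B 1) * (c1 • TensorProduct.map Ai 1 + c2 • TensorProduct.map B Bi) =
      (c1 • TensorProduct.map Ai 1 + c2 • TensorProduct.map B Bi) * (c3 • TensorProduct.map Ai B + c4 • TensorProduct.map B 1)) ∧
    (TensorProduct.map A A * (d • TensorProduct.map B (Ai * Bi)) = (d • TensorProduct.map B (Ai * Bi)) * TensorProduct.map A A) ∧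
    ((c3 • TensorProduct.map Ai B + c4 • TensorProduct.map B 1) * (d • TensorProduct.map B (Ai * Bi)) =
      (d • TensorProduct.map B (Ai * Bi)) * (c3 • TensorProduct.map Ai B + c4 • TensorProduct.map B 1)) ∧
    ((d • TensorProduct.map B (Ai * Bi)) * (c1 • TensorProduct.map Ai 1 + c2 • TensorProduct.map B Bi) =
      q ^ 2 • ((c1 • TensorProduct.map Ai 1 + c2 • TensorProduct.map B Bi) * (d • TensorProduct.map B (Ai * Bi)))) ∧
    ((d • TensorProduct.map B (Ai * Bi)) * TensorProduct.map A A = d • TensorProduct.map (A * B) Bi) := by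
  have hw : q ^ 2 ≠ 0 := pow_ne_zero 2 hq
  have r1 := weyl_inv_left _ hw A B Ai h a1 a2
  have r2 := weyl_inv_right _ hw A B Bi h b1 b2
  have r3 := weyl_inv_right _ (inv_ne_zero hw) Ai B Bi r1 b1 b2
  rw [inv_inv] at r3
  have h' : ∀ x, A * (B * x) = q ^ 2 • (B * (A * x)) := fun x => by
    rw [← mul_assoc, h, smul_mul_assoc, mul_assoc]
  have r1' : ∀ x, Ai * (B * x) = (q ^ 2)⁻¹ • (B * (Ai * x)) := fun x => by
    rw [← mul_assoc, r1, smul_mul_assoc, mul_assoc]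
  have r2' : ∀ x, A * (Bi * x) = (q ^ 2)⁻¹ • (Bi * (A * x)) := fun x => by
    rw [← mul_assoc, r2, smul_mul_assoc, mul_assoc]
  have r3' : ∀ x, Ai * (Bi * x) = (q ^ 2) • (Bi * (Ai * x)) := fun x => by
    rw [← mul_assoc, r3, smul_mul_assoc, mul_assoc]
  have a1' : ∀ x, A * (Ai * x) = x := fun x => by rw [← mul_assoc, a1, one_mul]
  have a2' : ∀ x, Ai * (A * x) = x := fun x => by rw [← mul_assoc, a2, one_mul]
  have b1' : ∀ x, B * (Bi * x) = x := fun x => by rw [← mul_assoc, b1, one_mul]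
  have b2' : ∀ x, Bi * (B * x) = x := fun x => by rw [← mul_assoc, b2, one_mul]
  refine ⟨?_, ?_, ?_, ?_, ?_, ?_⟩
  all_goals
    simp only [mul_add, add_mul, smul_mul_assoc, mul_smul_comm, smul_smul, smul_add,
      ← TensorProduct.map_mul, TensorProduct.map_smul_left, TensorProduct.map_smul_right,
      mul_assoc, one_mul, mul_one, h, r1, r2, r3, h', r1', r2', r3', a1, a2, b1, b2,
      a1', a2', b1', b2']
  all_goals
    match_scalars <;> field_simp
  all_goals linear_combination (q ^ 2 - 1) * hc

lemma P_unit (q : ℂ) (N : ℕ) (hN : 1 ≤ N) (hq : IsPrimitiveRoot (q ^ 2) N)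
    (A B Ai Bi : Module.End ℂ V)
    (a1 : A * Ai = 1) (a2 : Ai * A = 1)
    (h : A * B = q ^ 2 • (B * A)) (hA : A ^ N = 1) (hB : B ^ N = 1) (hBi : Bi ^ N = 1)
    (c1 c2 : ℂ) (h1 : c1 ≠ 0) (hc : c1 ^ N + c2 ^ N ≠ 0) :
    IsUnit (c1 • TensorProduct.map Ai 1 + c2 • TensorProduct.map B Bi :
      Module.End ℂ (V ⊗[ℂ] V)) := by
  have e : (c1 • TensorProduct.map Ai 1 + c2 • TensorProduct.map B Bi :
      Module.End ℂ (V ⊗[ℂ] V)) = (c1 • TensorProduct.map Ai 1) *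
        (1 + (c2 / c1) • TensorProduct.map (A * B) Bi) := by
    rw [mul_add, mul_one, smul_mul_smul_comm, ← TensorProduct.map_mul, ← mul_assoc, a2, one_mul,
      one_mul, mul_div_cancel₀ _ h1]
  rw [e]
  refine IsUnit.mul ?_ (unit_one_add _ N ((c2 / c1) ^ N * (-1) ^ (N - 1)) ?_ ?_)
  · refine ⟨⟨c1 • TensorProduct.map Ai 1, c1⁻¹ • TensorProduct.map A 1, ?_, ?_⟩, rfl⟩
    · rw [smul_mul_smul_comm, ← TensorProduct.map_mul, a2, one_mul, mul_inv_cancel₀ h1, one_smul,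
        TensorProduct.map_one]
    · rw [smul_mul_smul_comm, ← TensorProduct.map_mul, a1, one_mul, inv_mul_cancel₀ h1, one_smul,
        TensorProduct.map_one]
  · rw [smul_pow, TensorProduct.map_pow, h, smul_pow, weyl_pow _ _ _ h, hA, hB, hBi,
      hq.pow_eq_one, one_smul, root_sign _ N hN hq, TensorProduct.map_smul_left, mul_one,
      TensorProduct.map_one, smul_smul]
  · intro h2
    apply hc
    have e2 : (-1 : ℂ) ^ N * ((c2 / c1) ^ N * (-1) ^ (N - 1)) = -(c2 / c1) ^ N := by
      obtain ⟨m, rfl⟩ : ∃ m, N = m + 1 := ⟨N - 1, by omega⟩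
      rw [Nat.add_sub_cancel]
      have : ((-1 : ℂ) ^ m) * (-1) ^ m = 1 := by rw [← mul_pow]; simp
      linear_combination (-(c2 / c1) ^ (m + 1)) * this
    rw [e2, div_pow] at h2
    have := pow_ne_zero N h1
    field_simp at h2
    linear_combination -h2

end tens

lemma comm_inverse {R : Type*} [MonoidWithZero R] (p d : R) (hp : IsUnit p) (h : d * p = p * d) :
    d * Ring.inverse p = Ring.inverse p * d := by
  obtain ⟨p, rfl⟩ := hp
  rw [Ring.inverse_unit]
  exact (Commute.units_inv_right (show Commute d p from h)).eq

/-- Post-composition by an operator preserving a subspace of maps. -/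
def postc {V W : Type*} [AddCommGroup V] [Module ℂ V] [AddCommGroup W] [Module ℂ W]
    (S : Submodule ℂ (V →ₗ[ℂ] W)) (T : Module.End ℂ W) (h : ∀ f ∈ S, T ∘ₗ f ∈ S) :
    Module.End ℂ S where
  toFun f := ⟨T ∘ₗ f.1, h _ f.2⟩
  map_add' f g := Subtype.ext (by simp [LinearMap.comp_add])
  map_smul' c f := Subtype.ext (by simp [LinearMap.comp_smul])

lemma CG_post (N : ℕ) (Xa Ya Xb Yb Xab Yab : Module.End ℂ (CN N))
    (T : Module.End ℂ (CN N ⊗[ℂ] CN N))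
    (h1 : TensorProduct.map Xa Xb * T = T * TensorProduct.map Xa Xb)
    (h2 : (TensorProduct.map (Ring.inverse Xa) Yb + TensorProduct.map Ya 1) * T =
      T * (TensorProduct.map (Ring.inverse Xa) Yb + TensorProduct.map Ya 1)) :
    ∀ f ∈ CGsub N Xa Ya Xb Yb Xab Yab, T ∘ₗ f ∈ CGsub N Xa Ya Xb Yb Xab Yab := by
  rintro f ⟨f1, f2⟩
  refine ⟨?_, ?_⟩
  · rw [LinearMap.comp_assoc, f1, ← LinearMap.comp_assoc, ← LinearMap.comp_assoc,
      ← Module.End.mul_eq_comp, ← Module.End.mul_eq_comp, h1]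
  · rw [LinearMap.comp_assoc, f2, ← LinearMap.comp_assoc, ← LinearMap.comp_assoc,
      ← Module.End.mul_eq_comp, ← Module.End.mul_eq_comp, h2]

lemma postc_unit {V W : Type*} [AddCommGroup V] [Module ℂ V] [AddCommGroup W] [Module ℂ W]
    (S : Submodule ℂ (V →ₗ[ℂ] W)) (T T' : Module.End ℂ W) (h : ∀ f ∈ S, T ∘ₗ f ∈ S)
    (h' : ∀ f ∈ S, T' ∘ₗ f ∈ S) (e1 : T * T' = 1) (e2 : T' * T = 1) : IsUnit (postc S T h) := by
  refine ⟨⟨postc S T h, postc S T' h', ?_, ?_⟩, rfl⟩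
  · refine LinearMap.ext fun f => Subtype.ext (LinearMap.ext fun w => ?_)
    exact LinearMap.congr_fun e1 (f.1 w)
  · refine LinearMap.ext fun f => Subtype.ext (LinearMap.ext fun w => ?_)
    exact LinearMap.congr_fun e2 (f.1 w)

/-- for a regular pair (μ,ν), the operators f ↦ P⁻¹∘f and f ↦ Q∘f
are well defined on the Clebsch–Gordan space, are the unique pair (X̂, Ŷ) of
endomorphisms satisfying (X̂f)(w) = P⁻¹(f(w)) and (Ŷf)(X_{μν}w) = (q⁻¹X_μY_μ⊗Y_ν⁻¹)(f(w)),
with Ŷf = Q∘f, and they form a Weyl pair on V_{(μ,ν)}. -/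
theorem stmt17 (N : ℕ) (hN : 1 ≤ N) (q : ℂ) (hq : IsPrimitiveRoot (q ^ 2) N)
    (u v u' v' u'' v'' : ℂ) (hu : u ≠ 0) (hv : v ≠ 0) (hu' : u' ≠ 0) (hv' : v' ≠ 0)
    (hu'' : u'' ≠ 0) (hv'' : v'' ≠ 0)
    (hreg : (u ^ N)⁻¹ * v' ^ N + v ^ N ≠ 0)
    (hx : u'' ^ N = u ^ N * u' ^ N) (hy : v'' ^ N = (u ^ N)⁻¹ * v' ^ N + v ^ N) :
    let Xμ : Module.End ℂ (CN N) := u • opA q N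
    let Yμ : Module.End ℂ (CN N) := v • opB N
    let Xν : Module.End ℂ (CN N) := u' • opA q N
    let Yν : Module.End ℂ (CN N) := v' • opB N
    let Xμν : Module.End ℂ (CN N) := u'' • opA q N
    let Yμν : Module.End ℂ (CN N) := v'' • opB N
    let CG := CGsub N Xμ Yμ Xν Yν Xμν Yμν
    let P : Module.End ℂ (CN N ⊗[ℂ] CN N) :=
      TensorProduct.map (Ring.inverse Xμ) 1 + TensorProduct.map Yμ (Ring.inverse Yν)
    let Q : Module.End ℂ (CN N ⊗[ℂ] CN N) :=
      q⁻¹ • TensorProduct.map Yμ (Ring.inverse Xν * Ring.inverse Yν)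
    -- well-definedness of the two operators on the Clebsch-Gordan space
    (∀ f : CG, Ring.inverse P ∘ₗ (f : CN N →ₗ[ℂ] CN N ⊗[ℂ] CN N) ∈ CG ∧
      Q ∘ₗ (f : CN N →ₗ[ℂ] CN N ⊗[ℂ] CN N) ∈ CG) ∧
    -- existence, defining properties, explicit form, Weyl pair property, uniqueness
    ∃ Xh Yh : Module.End ℂ ↥CG,
      (∀ (f : CG) (w : CN N),
        (Xh f : CN N →ₗ[ℂ] CN N ⊗[ℂ] CN N) w =
          Ring.inverse P ((f : CN N →ₗ[ℂ] CN N ⊗[ℂ] CN N) w) ∧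
        (Yh f : CN N →ₗ[ℂ] CN N ⊗[ℂ] CN N) (Xμν w) =
          (q⁻¹ • TensorProduct.map (Xμ * Yμ) (Ring.inverse Yν))
            ((f : CN N →ₗ[ℂ] CN N ⊗[ℂ] CN N) w)) ∧
      (∀ f : CG, (Yh f : CN N →ₗ[ℂ] CN N ⊗[ℂ] CN N) =
        Q ∘ₗ (f : CN N →ₗ[ℂ] CN N ⊗[ℂ] CN N)) ∧
      IsWeylPair q Xh Yh ∧
      (∀ Xh' Yh' : Module.End ℂ ↥CG,
        (∀ (f : CG) (w : CN N),
          (Xh' f : CN N →ₗ[ℂ] CN N ⊗[ℂ] CN N) w =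
            Ring.inverse P ((f : CN N →ₗ[ℂ] CN N ⊗[ℂ] CN N) w) ∧
          (Yh' f : CN N →ₗ[ℂ] CN N ⊗[ℂ] CN N) (Xμν w) =
            (q⁻¹ • TensorProduct.map (Xμ * Yμ) (Ring.inverse Yν))
              ((f : CN N →ₗ[ℂ] CN N ⊗[ℂ] CN N) w)) →
        Xh' = Xh ∧ Yh' = Yh) := by
  have : NeZero N := ⟨by omega⟩
  have hq0 : q ≠ 0 := by
    rintro rfl
    have := hq.pow_eq_one
    rw [zero_pow two_ne_zero, zero_pow (by omega)] at this
    exact zero_ne_one this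
  obtain ⟨A, hA⟩ : ∃ A, A = opA q N := ⟨_, rfl⟩
  obtain ⟨B, hB⟩ : ∃ B, B = opB N := ⟨_, rfl⟩
  have hAN : A ^ N = 1 := hA ▸ opA_pow_N q N hq.pow_eq_one
  have hBN : B ^ N = 1 := hB ▸ opB_pow_N N
  have hAB : A * B = q ^ 2 • (B * A) := by rw [hA, hB]; exact opAB q N hq.pow_eq_one
  have hN1 : N - 1 + 1 = N := by omega
  have a1 : A * A ^ (N - 1) = 1 := by rw [← pow_succ', hN1, hAN]
  have a2 : A ^ (N - 1) * A = 1 := by rw [← pow_succ, hN1, hAN]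
  have b1 : B * B ^ (N - 1) = 1 := by rw [← pow_succ', hN1, hBN]
  have b2 : B ^ (N - 1) * B = 1 := by rw [← pow_succ, hN1, hBN]
  have hBiN : (B ^ (N - 1)) ^ N = 1 := by rw [← pow_mul, mul_comm, pow_mul, hBN, one_pow]
  generalize A ^ (N - 1) = Ai at a1 a2
  generalize B ^ (N - 1) = Bi at b1 b2 hBiN
  intro Xμ Yμ Xν Yν Xμν Yμν CG P Q
  have iXμ : Ring.inverse Xμ = u⁻¹ • Ai := inverse_smul' u hu _ _ (hA ▸ a1) (hA ▸ a2)
  have iXν : Ring.inverse Xν = u'⁻¹ • Ai := inverse_smul' u' hu' _ _ (hA ▸ a1) (hA ▸ a2)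
  have iYν : Ring.inverse Yν = v'⁻¹ • Bi := inverse_smul' v' hv' _ _ (hB ▸ b1) (hB ▸ b2)
  have eP : P = u⁻¹ • TensorProduct.map Ai 1 + (v * v'⁻¹) • TensorProduct.map B Bi := by
    simp only [P, iXμ, iYν, Yμ, ← hB, TensorProduct.map_smul_left, TensorProduct.map_smul_right,
      smul_smul]
    try rw [mul_comm v]
  have eQ : Q = (q⁻¹ * v * u'⁻¹ * v'⁻¹) • TensorProduct.map B (Ai * Bi) := by
    simp only [Q, iXν, iYν, Yμ, ← hB, TensorProduct.map_smul_left, TensorProduct.map_smul_right,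
      smul_smul, smul_mul_smul_comm]
    congr 1
    ring
  have eD : TensorProduct.map Xμ Xν = (u * u') • TensorProduct.map A A := by
    simp only [Xμ, Xν, ← hA, TensorProduct.map_smul_left, TensorProduct.map_smul_right, smul_smul]
    try rw [mul_comm u]
  have eE : TensorProduct.map (Ring.inverse Xμ) Yν + TensorProduct.map Yμ 1 =
      (u⁻¹ * v') • TensorProduct.map Ai B + v • TensorProduct.map B 1 := by
    simp only [iXμ, Yμ, Yν, ← hB, TensorProduct.map_smul_left, TensorProduct.map_smul_right,
      smul_smul]
    try rw [mul_comm u⁻¹]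
  have eR : q⁻¹ • TensorProduct.map (Xμ * Yμ) (Ring.inverse Yν) =
      (q⁻¹ * u * v * v'⁻¹) • TensorProduct.map (A * B) Bi := by
    simp only [iYν, Xμ, Yμ, ← hB, ← hA, TensorProduct.map_smul_left, TensorProduct.map_smul_right,
      smul_smul, smul_mul_smul_comm]
    congr 1
    ring
  obtain ⟨t1, t2, t3, t4, t5, t6⟩ := tens_facts q hq0 A B Ai Bi a1 a2 b1 b2 hAB
    u⁻¹ (v * v'⁻¹) (u⁻¹ * v') v (q⁻¹ * v * u'⁻¹ * v'⁻¹) (by field_simp)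
  rw [← eP] at t1 t2 t5
  rw [← eE] at t2 t4
  rw [← eQ] at t3 t4 t5 t6
  have uP : IsUnit P := by
    rw [eP]
    refine P_unit q N hN hq A B Ai Bi a1 a2 hAB hAN hBN hBiN _ _ (inv_ne_zero hu) ?_
    intro h0
    apply hreg
    have := pow_ne_zero N hv'
    rw [mul_pow, inv_pow, inv_pow] at h0
    have h1 := congrArg (· * v' ^ N) h0
    simp only [add_mul, zero_mul, mul_assoc, inv_mul_cancel₀ this, mul_one] at h1
    exact h1
  have uQ : IsUnit Q := by
    rw [eQ]
    have hc : q⁻¹ * v * u'⁻¹ * v'⁻¹ ≠ 0 := by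
      simp [hq0, hv, hu', hv']
    refine ⟨⟨_, (q⁻¹ * v * u'⁻¹ * v'⁻¹)⁻¹ • TensorProduct.map Bi (B * A), ?_, ?_⟩, rfl⟩
    · rw [smul_mul_smul_comm, ← TensorProduct.map_mul, b1, mul_inv_cancel₀ hc, one_smul,
        mul_assoc, ← mul_assoc Bi, b2, one_mul, a2, TensorProduct.map_one]
    · rw [smul_mul_smul_comm, ← TensorProduct.map_mul, b2, inv_mul_cancel₀ hc, one_smul,
        mul_assoc, ← mul_assoc A, a1, one_mul, b1, TensorProduct.map_one]
  have dP : TensorProduct.map Xμ Xν * P = P * TensorProduct.map Xμ Xν := by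
    rw [eD, smul_mul_assoc, t1, mul_smul_comm]
  have dQ : TensorProduct.map Xμ Xν * Q = Q * TensorProduct.map Xμ Xν := by
    rw [eD, smul_mul_assoc, t3, mul_smul_comm]
  have kP : ∀ f ∈ CG, P ∘ₗ f ∈ CG := CG_post _ _ _ _ _ _ _ _ dP t2
  have kQ : ∀ f ∈ CG, Q ∘ₗ f ∈ CG := CG_post _ _ _ _ _ _ _ _ dQ t4
  have kPi : ∀ f ∈ CG, Ring.inverse P ∘ₗ f ∈ CG :=
    CG_post _ _ _ _ _ _ _ _ (comm_inverse _ _ uP dP) (comm_inverse _ _ uP t2)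
  have kQi : ∀ f ∈ CG, Ring.inverse Q ∘ₗ f ∈ CG :=
    CG_post _ _ _ _ _ _ _ _ (comm_inverse _ _ uQ dQ) (comm_inverse _ _ uQ t4)
  have wey : Ring.inverse P * Q = q ^ 2 • (Q * Ring.inverse P) := by
    rw [Ring.inverse_mul_eq_iff_eq_mul _ _ _ uP, mul_smul_comm, ← mul_assoc, ← smul_mul_assoc,
      ← t5, mul_assoc, Ring.mul_inverse_cancel _ uP, mul_one]
  have hR : Q * TensorProduct.map Xμ Xν =
      q⁻¹ • TensorProduct.map (Xμ * Yμ) (Ring.inverse Yν) := by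
    rw [eR, eD, mul_smul_comm, t6, smul_smul]
    congr 1
    field_simp
  have sX : ∀ w, Xμν (u''⁻¹ • Ai w) = w := fun w => by
    have : A (Ai w) = w := LinearMap.congr_fun a1 w
    change u'' • (opA q N) (u''⁻¹ • Ai w) = w
    rw [← hA, map_smul, this, smul_smul, mul_inv_cancel₀ hu'', one_smul]
  refine ⟨fun f => ⟨kPi f f.2, kQ f f.2⟩, postc CG _ kPi, postc CG _ kQ, ?_, fun f => rfl,
    ⟨postc_unit CG _ P _ kP (Ring.inverse_mul_cancel _ uP) (Ring.mul_inverse_cancel _ uP),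
      postc_unit CG _ _ _ kQi (Ring.mul_inverse_cancel _ uQ) (Ring.inverse_mul_cancel _ uQ), ?_⟩, ?_⟩
  · intro f w
    refine ⟨rfl, ?_⟩
    rw [← hR]
    have : f.1 (Xμν w) = TensorProduct.map Xμ Xν (f.1 w) := LinearMap.congr_fun f.2.1 w
    change Q (f.1 (Xμν w)) = Q (TensorProduct.map Xμ Xν (f.1 w))
    rw [this]
  · refine LinearMap.ext fun f => Subtype.ext (LinearMap.ext fun w => ?_)
    exact LinearMap.congr_fun wey (f.1 w)
  · intro Xh' Yh' h
    refine ⟨LinearMap.ext fun f => Subtype.ext (LinearMap.ext fun w => (h f w).1),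
      LinearMap.ext fun f => Subtype.ext (LinearMap.ext fun w => ?_)⟩
    have h2 := (h f (u''⁻¹ • Ai w)).2
    rw [sX, ← hR] at h2
    rw [h2]
    have : f.1 (Xμν (u''⁻¹ • Ai w)) = TensorProduct.map Xμ Xν (f.1 (u''⁻¹ • Ai w)) :=
      LinearMap.congr_fun f.2.1 _
    rw [sX] at this
    change Q (TensorProduct.map Xμ Xν (f.1 (u''⁻¹ • Ai w))) = Q (f.1 w)
    rw [this]

end
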